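/- For every n ≥ 2 and every load vector ℓ ∈ ℤⁿ, the average of the potential after one balancing step satisfies (1/\binom{n}{2}) · ∑_{1 ≤ i < j ≤ n} Φ(balance(ℓ,i,j)) ≤ (1 − 1/n) · Φ(ℓ) + 1/2. -/

import Mathlib

open scoped BigOperators

/-- `balance ℓ u v` replaces `ℓ u` by `⌈(ℓ u + ℓ v)/2⌉` and `ℓ v` by `⌊(ℓ u + ℓ v)/2⌋`. -/
noncomputable def balance {n : ℕ} (ℓ : Fin n → ℤ) (u v : Fin n) : Fin n → ℤ :=
  fun i =>
    if i = u then ⌈(((ℓ u + ℓ v : ℤ) : ℚ)) / 2⌉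
    else if i = v then ⌊(((ℓ u + ℓ v : ℤ) : ℚ)) / 2⌋
    else ℓ i

/-- The potential `Φ(ℓ) = ∑ i (ℓ i − ā)²`, where `ā = (∑ i ℓ i)/n` is the average load. -/
noncomputable def potential {n : ℕ} (ℓ : Fin n → ℤ) : ℝ :=
  ∑ i, ((ℓ i : ℝ) - ((∑ j, ℓ j : ℤ) : ℝ) / n) ^ 2

lemma balance_left_add_right {n : ℕ} (ℓ : Fin n → ℤ) {u v : Fin n} (h : u ≠ v) :
    balance ℓ u v u + balance ℓ u v v = ℓ u + ℓ v ∧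
      balance ℓ u v u - balance ℓ u v v ∈ Set.Icc 0 1 := by
  have hc : ⌈(((ℓ u + ℓ v : ℤ) : ℚ)) / 2⌉ = (ℓ u + ℓ v + 1) / 2 := by
    rw [Int.ceil_eq_iff]
    have h₁ : 2 * ((ℓ u + ℓ v + 1) / 2) ≤ ℓ u + ℓ v + 1 := by omega
    have h₂ : ℓ u + ℓ v ≤ 2 * ((ℓ u + ℓ v + 1) / 2) := by omega
    generalize (ℓ u + ℓ v + 1) / 2 = q at *
    qify at h₁ h₂
    push_cast
    constructor <;> linarith
  have hf : ⌊(((ℓ u + ℓ v : ℤ) : ℚ)) / 2⌋ = (ℓ u + ℓ v) / 2 := by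
    exact_mod_cast Rat.floor_intCast_div_natCast (ℓ u + ℓ v) 2
  simp only [balance, if_neg h.symm, if_true, hc, hf, Set.mem_Icc]
  omega

lemma sum_eq_sum_add_of_eq_off_pair {ι M : Type*} [Fintype ι] [AddCommGroup M]
    {f g : ι → M} {u v : ι} (h : u ≠ v) (hfg : ∀ i, i ≠ u → i ≠ v → f i = g i) :
    ∑ i, f i = ∑ i, g i + ((f u - g u) + (f v - g v)) := by
  rw [← Fintype.sum_eq_add (f := fun i => f i - g i) u v h
    (fun i hi => sub_eq_zero.2 (hfg i hi.1 hi.2)), Finset.sum_sub_distrib]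
  abel

lemma balance_of_ne {n : ℕ} (ℓ : Fin n → ℤ) {u v i : Fin n} (hu : i ≠ u) (hv : i ≠ v) :
    balance ℓ u v i = ℓ i := by
  simp [balance, hu, hv]

lemma sum_balance {n : ℕ} (ℓ : Fin n → ℤ) {u v : Fin n} (h : u ≠ v) :
    ∑ i, balance ℓ u v i = ∑ i, ℓ i := by
  rw [sum_eq_sum_add_of_eq_off_pair h fun i hu hv => balance_of_ne ℓ hu hv]
  linarith [(balance_left_add_right ℓ h).1]

lemma potential_balance_le {n : ℕ} (ℓ : Fin n → ℤ) {u v : Fin n} (h : u ≠ v) :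
    potential (balance ℓ u v) ≤ potential ℓ + 1 / 2 - ((ℓ u : ℝ) - ℓ v) ^ 2 / 2 := by
  unfold potential
  rw [sum_balance ℓ h]
  generalize ((∑ j, ℓ j : ℤ) : ℝ) / n = m
  rw [sum_eq_sum_add_of_eq_off_pair (g := fun i => ((ℓ i : ℝ) - m) ^ 2) h
    fun i hu hv => by rw [balance_of_ne ℓ hu hv]]
  obtain ⟨hs, hd₀, hd₁⟩ := balance_left_add_right ℓ h
  generalize balance ℓ u v u = a at *
  generalize balance ℓ u v v = b at *
  have hs' : (a : ℝ) + b = ℓ u + ℓ v := mod_cast hs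
  have h₀ : (0 : ℝ) ≤ a - b := mod_cast hd₀
  have h₁ : (a : ℝ) - b ≤ 1 := mod_cast hd₁
  have ha : (a : ℝ) = ℓ u + ℓ v - b := by linarith
  have hsq : ((a : ℝ) - b) ^ 2 ≤ 1 := by nlinarith
  rw [ha] at hsq ⊢
  nlinarith

lemma sum_sum_sub_sq {n : ℕ} (hn : n ≠ 0) (ℓ : Fin n → ℤ) :
    ∑ i, ∑ j, ((ℓ i : ℝ) - ℓ j) ^ 2 = 2 * n * potential ℓ := by
  have hn' : (n : ℝ) ≠ 0 := mod_cast hn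
  simp only [potential, sub_sq, Finset.sum_add_distrib, Finset.sum_sub_distrib,
    ← Finset.mul_sum, ← Finset.sum_mul, Finset.sum_const, Finset.card_univ, Fintype.card_fin,
    nsmul_eq_mul, Int.cast_sum]
  field_simp
  ring

lemma sum_sum_eq_two_mul_sum_lt {ι : Type*} [Fintype ι] [LinearOrder ι] (f : ι → ι → ℝ)
    (hf : ∀ i j, f i j = f j i) :
    ∑ i, ∑ j, f i j = 2 * ∑ i, ∑ j with i < j, f i j + ∑ i, f i i := by
  have hsplit : ∀ i j, f i j =
      (if i < j then f i j else 0) + (if j < i then f j i else 0) +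
        (if i = j then f i j else 0) := by
    intro i j
    rcases lt_trichotomy i j with h | rfl | h
    · simp [h, h.not_gt, h.ne]
    · simp
    · simp [h, h.not_gt, h.ne', hf i j]
  have hswap : ∑ i, ∑ j, (if j < i then f j i else 0) =
      ∑ i, ∑ j, (if i < j then f i j else 0) := Finset.sum_comm
  rw [Finset.sum_congr rfl fun i _ => Finset.sum_congr rfl fun j _ => hsplit i j]
  simp only [Finset.sum_add_distrib, hswap, Finset.sum_filter, Finset.sum_ite_eq,
    Finset.mem_univ, if_true]
  ring

/-- **Expected potential drop in one step.** For `n ≥ 2` and any load vector `ℓ ∈ ℤⁿ`, the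
average over the `n choose 2` unordered pairs of `Φ(balance ℓ i j)` is at most
`(1 − 1/n)·Φ(ℓ) + 1/2`. -/
theorem expected_potential_after_one_step (n : ℕ) (hn : 2 ≤ n) (ℓ : Fin n → ℤ) :
    (1 / (n.choose 2 : ℝ)) *
        (∑ i : Fin n, ∑ j ∈ Finset.univ.filter (fun j : Fin n => i < j),
          potential (balance ℓ i j))
      ≤ (1 - 1 / (n : ℝ)) * potential ℓ + 1 / 2 := by
  have hn₂ : (2 : ℝ) ≤ n := mod_cast hn
  have hΦ : 0 ≤ potential ℓ := Finset.sum_nonneg fun i _ => sq_nonneg _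
  have hle : ∑ i : Fin n, ∑ j with i < j, potential (balance ℓ i j) ≤
      ∑ i : Fin n, ∑ j with i < j, (potential ℓ + 1 / 2 - ((ℓ i : ℝ) - ℓ j) ^ 2 / 2) :=
    Finset.sum_le_sum fun i _ => Finset.sum_le_sum fun j hj =>
      potential_balance_le ℓ (Finset.mem_filter.1 hj).2.ne
  have hsum := sum_sum_eq_two_mul_sum_lt
    (fun i j => potential ℓ + 1 / 2 - ((ℓ i : ℝ) - ℓ j) ^ 2 / 2) fun i j => by ring
  simp only [Finset.sum_sub_distrib (s := Finset.univ), ← Finset.sum_div,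
    sum_sum_sub_sq (by omega : n ≠ 0) ℓ,
    sub_self, Finset.sum_const, Finset.card_univ, Fintype.card_fin, nsmul_eq_mul] at hsum
  have hpos : (0 : ℝ) < n * (n - 1) / 2 := by nlinarith
  rw [Nat.cast_choose_two, one_div_mul_eq_div, div_le_iff₀ hpos]
  have hrhs : ((1 - 1 / (n : ℝ)) * potential ℓ + 1 / 2) * (n * (n - 1) / 2) =
      ((n - 1) ^ 2 * potential ℓ + n * (n - 1) / 2) / 2 := by
    field_simp
  rw [hrhs]
  nlinarith
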